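/- Hölder–Pinsker–Jensen bound from the proof of Lemma D.1. Let d be a probability distribution on the finite set S, and let π', q, π be policies such that q(a|s) > 0 and π(a|s) > 0 for all (s,a) and max_{s∈S} max_{a∈A} |log(q(a|s)/π(a|s))| ≤ M' for some M' ≥ 0. Then E_{s∼d}[ ∑_{a∈A} (π'(a|s) − q(a|s))·log(q(a|s)/π(a|s)) ] ≤ M'·√(2·E_{s∼d}[KL(π'‖q)(s)]). -/

import Mathlib

open scoped BigOperators

noncomputable section

variable {S A : Type*}

/-- `f` is a probability mass function on a finite type. -/
def IsPMF [Fintype S] (f : S → ℝ) : Prop :=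
  (∀ s, 0 ≤ f s) ∧ ∑ s, f s = 1

/-- `π` is a policy: for each state, a probability distribution over actions. -/
def IsPolicy [Fintype A] (π : S → A → ℝ) : Prop :=
  ∀ s, (∀ a, 0 ≤ π s a) ∧ ∑ a, π s a = 1

/-- `p` is a transition kernel: for each state-action pair, a probability
distribution over next states. -/
def IsKernel [Fintype S] (p : S → A → S → ℝ) : Prop :=
  ∀ s a, (∀ s', 0 ≤ p s a s') ∧ ∑ s', p s a s' = 1

/-- One step of state-distribution evolution under policy `π` and kernel `p`. -/
def step [Fintype S] [Fintype A] (π : S → A → ℝ) (p : S → A → S → ℝ)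
    (μ : S → ℝ) : S → ℝ :=
  fun s' => ∑ s, ∑ a, μ s * π s a * p s a s'

/-- Distribution of the state at time `t`, starting from initial distribution `ρ`. -/
def stateDist [Fintype S] [Fintype A] (π : S → A → ℝ) (p : S → A → S → ℝ)
    (ρ : S → ℝ) (t : ℕ) : S → ℝ :=
  (step π p)^[t] ρ

/-- Discounted value function `V_{r,p}^π(ρ)`. -/
def valueV [Fintype S] [Fintype A] (γ : ℝ) (r : S → A → ℝ)
    (π : S → A → ℝ) (p : S → A → S → ℝ) (ρ : S → ℝ) : ℝ :=
  ∑' t : ℕ, γ ^ t * ∑ s, ∑ a, stateDist π p ρ t s * π s a * r s a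

/-- Point mass at state `s`. -/
def dirac [DecidableEq S] (s : S) : S → ℝ :=
  fun s' => if s' = s then 1 else 0

/-- State value function `V_{r,p}^π(s)`. -/
def stateValue [Fintype S] [Fintype A] [DecidableEq S] (γ : ℝ) (r : S → A → ℝ)
    (π : S → A → ℝ) (p : S → A → S → ℝ) (s : S) : ℝ :=
  valueV γ r π p (dirac s)

/-- Action value function `Q_{r,p}^π(s,a)`. -/
def actionValue [Fintype S] [Fintype A] [DecidableEq S] (γ : ℝ) (r : S → A → ℝ)
    (π : S → A → ℝ) (p : S → A → S → ℝ) (s : S) (a : A) : ℝ :=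
  r s a + γ * ∑ s', p s a s' * stateValue γ r π p s'

/-- Advantage function `A_{r,p}^π(s,a) = Q_{r,p}^π(s,a) - V_{r,p}^π(s)`. -/
def advantage [Fintype S] [Fintype A] [DecidableEq S] (γ : ℝ) (r : S → A → ℝ)
    (π : S → A → ℝ) (p : S → A → S → ℝ) (s : S) (a : A) : ℝ :=
  actionValue γ r π p s a - stateValue γ r π p s

/-- Discounted state occupancy measure `d_p^π(s)`. -/
def occupancy [Fintype S] [Fintype A] (γ : ℝ) (π : S → A → ℝ)
    (p : S → A → S → ℝ) (ρ : S → ℝ) (s : S) : ℝ :=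
  (1 - γ) * ∑' t : ℕ, γ ^ t * stateDist π p ρ t s

/-- Kullback–Leibler divergence `KL(π'‖π)(s)` between the action distributions
of two policies at state `s`. -/
def KLdiv [Fintype A] (π' π : S → A → ℝ) (s : S) : ℝ :=
  ∑ a, π' s a * Real.log (π' s a / π s a)

/-- Robust value function `V^π(ρ) = inf_{p ∈ P} V_{r,p}^π(ρ)`. -/
def robustValue [Fintype S] [Fintype A] (γ : ℝ) (r : S → A → ℝ)
    (π : S → A → ℝ) (P : Set (S → A → S → ℝ)) (ρ : S → ℝ) : ℝ :=
  sInf ((fun p => valueV γ r π p ρ) '' P)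

end

/-- The rational lower bound for the logarithm behind Pinsker's inequality. -/
theorem div_le_log_of_pos {x : ℝ} (hx : 0 < x) :
    (5 * x ^ 2 - 4 * x - 1) / (2 * x ^ 2 + 4 * x) ≤ Real.log x := by
  let F : ℝ → ℝ := fun y ↦ Real.log y - (5 * y ^ 2 - 4 * y - 1) / (2 * y ^ 2 + 4 * y)
  have hF : ∀ y : ℝ, 0 < y → HasDerivAt F (4 * (y - 1) ^ 3 / (2 * y ^ 2 + 4 * y) ^ 2) y := by
    intro y hy
    have hD : 2 * y ^ 2 + 4 * y ≠ 0 := by positivity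
    have hnum : HasDerivAt (fun z : ℝ ↦ 5 * z ^ 2 - 4 * z - 1) (10 * y - 4) y := by
      refine ((((hasDerivAt_pow 2 y).const_mul 5).sub
        ((hasDerivAt_id y).const_mul 4)).sub_const 1).congr_deriv ?_
      norm_num
      ring
    have hden : HasDerivAt (fun z : ℝ ↦ 2 * z ^ 2 + 4 * z) (4 * y + 4) y := by
      refine (((hasDerivAt_pow 2 y).const_mul 2).add
        ((hasDerivAt_id y).const_mul 4)).congr_deriv ?_
      norm_num
      ring
    refine ((Real.hasDerivAt_log hy.ne').sub (hnum.div hden hD)).congr_deriv ?_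
    field_simp
    ring
  have hF1 : F 1 = 0 := by norm_num [F]
  suffices 0 ≤ F x from sub_nonneg.mp this
  rcases le_total x 1 with h | h
  · have hanti : AntitoneOn F (Set.Icc x 1) := by
      refine antitoneOn_of_hasDerivWithinAt_nonpos (convex_Icc x 1)
        (fun y hy ↦ (hF y (hx.trans_le hy.1)).continuousAt.continuousWithinAt)
        (fun y hy ↦ (hF y (hx.trans_le (interior_subset hy).1)).hasDerivWithinAt) ?_
      intro y hy
      have hy1 : y - 1 ≤ 0 := sub_nonpos.mpr (interior_subset hy).2
      exact div_nonpos_of_nonpos_of_nonneg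
        (by nlinarith [mul_nonneg (sq_nonneg (y - 1)) (neg_nonneg.mpr hy1)]) (sq_nonneg _)
    exact hF1 ▸ hanti ⟨le_rfl, h⟩ ⟨h, le_rfl⟩ h
  · have hmono : MonotoneOn F (Set.Icc 1 x) := by
      refine monotoneOn_of_hasDerivWithinAt_nonneg (convex_Icc 1 x)
        (fun y hy ↦ (hF y (one_pos.trans_le hy.1)).continuousAt.continuousWithinAt)
        (fun y hy ↦ (hF y (one_pos.trans_le (interior_subset hy).1)).hasDerivWithinAt) ?_
      intro y hy
      have hy1 : 0 ≤ y - 1 := sub_nonneg.mpr (interior_subset hy).1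
      positivity
    exact hF1 ▸ hmono ⟨le_rfl, h⟩ ⟨h, le_rfl⟩ h

theorem sq_sub_le_mul_log_div {p q : ℝ} (hp : 0 ≤ p) (hq : 0 < q) :
    (p - q) ^ 2 ≤ (2 * p + 4 * q) / 3 * (p * Real.log (p / q) - p + q) := by
  rcases hp.eq_or_lt with rfl | hp
  · norm_num
    nlinarith [sq_nonneg q]
  · have h := mul_le_mul_of_nonneg_left (div_le_log_of_pos (div_pos hp hq))
      (show 0 ≤ (2 * p + 4 * q) / 3 * p by positivity)
    have hrat : (2 * p + 4 * q) / 3 * p * ((5 * (p / q) ^ 2 - 4 * (p / q) - 1) /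
        (2 * (p / q) ^ 2 + 4 * (p / q))) = (5 * p ^ 2 - 4 * p * q - q ^ 2) / 3 := by
      have : p + 2 * q ≠ 0 := by positivity
      field_simp
    rw [hrat] at h
    linarith

/-- **Pinsker's inequality** on a finite type. -/
theorem sq_sum_abs_sub_le_two_mul_sum_mul_log {A : Type*} [Fintype A] {p q : A → ℝ}
    (hp : IsPMF p) (hq : IsPMF q) (hqpos : ∀ a, 0 < q a) :
    (∑ a, |p a - q a|) ^ 2 ≤ 2 * ∑ a, p a * Real.log (p a / q a) := by
  have hlog (a : A) := sq_sub_le_mul_log_div (hp.1 a) (hqpos a)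
  have hw (a : A) : 0 < (2 * p a + 4 * q a) / 3 := by linarith [hp.1 a, hqpos a]
  have h := Finset.sum_sq_le_sum_mul_sum_of_sq_le_mul Finset.univ
    (r := fun a ↦ |p a - q a|) (f := fun a ↦ (2 * p a + 4 * q a) / 3)
    (g := fun a ↦ p a * Real.log (p a / q a) - p a + q a)
    (fun a _ ↦ (hw a).le)
    (fun a _ ↦ nonneg_of_mul_nonneg_right ((sq_nonneg _).trans (hlog a)) (hw a))
    (fun a _ ↦ (sq_abs (p a - q a)).trans_le (hlog a))
  rw [← Finset.sum_div, Finset.sum_add_distrib, ← Finset.mul_sum, ← Finset.mul_sum,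
    Finset.sum_add_distrib, Finset.sum_sub_distrib, hp.2, hq.2] at h
  linarith

/-- **Hölder–Pinsker–Jensen bound (proof of Lemma D.1).** -/
theorem holder_pinsker_jensen
    {S A : Type*} [Fintype S] [Fintype A] [Nonempty S] [Nonempty A]
    (dS : S → ℝ) (hd : IsPMF dS)
    (π' q π : S → A → ℝ) (hπ' : IsPolicy π') (hq : IsPolicy q) (hπ : IsPolicy π)
    (hqpos : ∀ s a, 0 < q s a) (hπpos : ∀ s a, 0 < π s a)
    (M' : ℝ) (hM'0 : 0 ≤ M')
    (hM' : ∀ s a, |Real.log (q s a / π s a)| ≤ M') :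
    ∑ s, dS s * ∑ a, (π' s a - q s a) * Real.log (q s a / π s a) ≤
      M' * Real.sqrt (2 * ∑ s, dS s * KLdiv π' q s) := by
  have hhol (s : S) : ∑ a, (π' s a - q s a) * Real.log (q s a / π s a) ≤
      M' * ∑ a, |π' s a - q s a| := by
    rw [Finset.mul_sum]
    refine Finset.sum_le_sum fun a _ ↦ (le_abs_self _).trans ?_
    rw [abs_mul, mul_comm]
    exact mul_le_mul_of_nonneg_right (hM' s a) (abs_nonneg _)
  have hpin (s : S) : (∑ a, |π' s a - q s a|) ^ 2 ≤ 2 * KLdiv π' q s :=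
    sq_sum_abs_sub_le_two_mul_sum_mul_log (hπ' s) (hq s) (hqpos s)
  have hjen := Finset.sum_sq_le_sum_mul_sum_of_sq_le_mul Finset.univ
    (r := fun s ↦ dS s * ∑ a, |π' s a - q s a|) (f := dS)
    (g := fun s ↦ dS s * (2 * KLdiv π' q s))
    (fun s _ ↦ hd.1 s)
    (fun s _ ↦ mul_nonneg (hd.1 s) ((sq_nonneg _).trans (hpin s)))
    (fun s _ ↦ by
      rw [mul_pow, ← mul_assoc, ← sq]
      exact mul_le_mul_of_nonneg_left (hpin s) (sq_nonneg _))
  rw [hd.2, one_mul] at hjen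
  calc
    _ ≤ ∑ s, dS s * (M' * ∑ a, |π' s a - q s a|) :=
      Finset.sum_le_sum fun s _ ↦ mul_le_mul_of_nonneg_left (hhol s) (hd.1 s)
    _ = M' * ∑ s, dS s * ∑ a, |π' s a - q s a| := by
      simp_rw [Finset.mul_sum, mul_left_comm]
    _ ≤ _ := by
      refine mul_le_mul_of_nonneg_left (Real.le_sqrt_of_sq_le (hjen.trans_eq ?_)) hM'0
      simp_rw [Finset.mul_sum, mul_left_comm]
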